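/- Let {f_ε}_{0≤ε≤ε₀} be a good family and let s_ε denote the scaling function of f_ε for 0 < ε ≤ ε₀. Then for every a* in the dual Cantor set C* the limit s₀(a*) of s_ε(a*) as ε decreases to 0 exists, and the limiting function s₀ is the scaling function of f₀, i.e. for every a* ∈ C* the ratios |I_{wₙi}|/|I_{wₙ}| computed from the partitions determined by f₀ converge to s₀(a*) as n → ∞. -/

import Mathlib

open Set MeasureTheory Filter Topology

noncomputable def len (s : Set ℝ) : ℝ := (volume s).toReal

noncomputable def branch (f : ℝ → ℝ) : Bool → ℝ → ℝ
  | false => Function.invFunOn f (Icc (-1) 0)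
  | true => Function.invFunOn f (Icc 0 1)

noncomputable def gw (f : ℝ → ℝ) : List Bool → ℝ → ℝ
  | [] => id
  | b :: w => branch f b ∘ gw f w

noncomputable def Iw (f : ℝ → ℝ) (w : List Bool) : Set ℝ := gw f w '' Icc (-1) 1

def word (a : ℕ → Bool) (n : ℕ) : List Bool := ((List.range (n + 1)).reverse).map a

noncomputable def ratio (f : ℝ → ℝ) (a : ℕ → Bool) (n : ℕ) : ℝ :=
  len (Iw f (word a n)) / len (Iw f ((word a n).dropLast))

def IsScalingFun (f : ℝ → ℝ) (s : (ℕ → Bool) → ℝ) : Prop :=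
  ∀ a : ℕ → Bool, Tendsto (ratio f a) atTop (nhds (s a))

def HolderOnDual (s : (ℕ → Bool) → ℝ) : Prop :=
  ∃ C > (0:ℝ), ∃ lam ∈ Ioo (0:ℝ) 1, ∀ a b : ℕ → Bool, ∀ n : ℕ,
    (∀ k < n, a k = b k) → |s a - s b| ≤ C * lam ^ n

def EvZero (a : ℕ → Bool) : Prop := ∃ N, ∀ n ≥ N, a n = false

def Lambda (f : ℝ → ℝ) : Set ℝ := {x | ∀ n : ℕ, f^[n] x ∈ Icc (-1) 1}

structure GoodFamily where
  eps0 : ℝ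
  eps0_pos : 0 < eps0
  f : ℝ → ℝ → ℝ
  f' : ℝ → ℝ → ℝ
  gamma : ℝ
  one_lt_gamma : 1 < gamma
  mono : ∀ ε ∈ Icc 0 eps0, StrictMonoOn (f ε) (Icc (-1) 0)
  anti : ∀ ε ∈ Icc 0 eps0, StrictAntiOn (f ε) (Icc 0 1)
  map_neg_one : ∀ ε ∈ Icc 0 eps0, f ε (-1) = -1
  map_one : ∀ ε ∈ Icc 0 eps0, f ε 1 = -1
  map_zero : ∀ ε ∈ Icc 0 eps0, f ε 0 = 1 + ε
  smooth : ContDiffOn ℝ 1 (fun p : ℝ × ℝ => f p.1 p.2) (Icc 0 eps0 ×ˢ Icc (-1) 1)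
  deriv_f : ∀ ε ∈ Icc 0 eps0, ∀ x ∈ Icc (-1:ℝ) 1,
    HasDerivWithinAt (f ε) (f' ε x) (Icc (-1) 1) x
  Rneg : ℝ → ℝ → ℝ
  Rpos : ℝ → ℝ → ℝ
  Rneg_cont : ContinuousOn (fun p : ℝ × ℝ => Rneg p.1 p.2) (Icc 0 eps0 ×ˢ Icc (-1) 0)
  Rpos_cont : ContinuousOn (fun p : ℝ × ℝ => Rpos p.1 p.2) (Icc 0 eps0 ×ˢ Icc 0 1)
  Rneg_ne : ∀ ε ∈ Icc 0 eps0, ∀ x ∈ Icc (-1:ℝ) 0, Rneg ε x ≠ 0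
  Rpos_ne : ∀ ε ∈ Icc 0 eps0, ∀ x ∈ Icc (0:ℝ) 1, Rpos ε x ≠ 0
  Rneg_eq : ∀ ε ∈ Icc 0 eps0, ∀ x ∈ Ico (-1:ℝ) 0, Rneg ε x = f' ε x / |x| ^ (gamma - 1)
  Rpos_eq : ∀ ε ∈ Icc 0 eps0, ∀ x ∈ Ioc (0:ℝ) 1, Rpos ε x = f' ε x / |x| ^ (gamma - 1)
  K' : ℝ
  K'_pos : 0 < K'
  alpha' : ℝ
  alpha'_mem : alpha' ∈ Ioc (0:ℝ) 1
  holder' : ∀ ε ∈ Icc 0 eps0, ∀ x ∈ Icc (-1:ℝ) 1, ∀ y ∈ Icc (-1:ℝ) 1,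
    |f' ε x - f' ε y| ≤ K' * |x - y| ^ alpha'
  K'' : ℝ
  K''_pos : 0 < K''
  alpha'' : ℝ
  alpha''_mem : alpha'' ∈ Ioc (0:ℝ) 1
  holder''_neg : ∀ ε ∈ Icc 0 eps0, ∀ x ∈ Ico (-1:ℝ) 0, ∀ y ∈ Ico (-1:ℝ) 0,
    |f' ε x / |x| ^ (gamma - 1) - f' ε y / |y| ^ (gamma - 1)| ≤ K'' * |x - y| ^ alpha''
  holder''_pos : ∀ ε ∈ Icc 0 eps0, ∀ x ∈ Ioc (0:ℝ) 1, ∀ y ∈ Ioc (0:ℝ) 1,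
    |f' ε x / |x| ^ (gamma - 1) - f' ε y / |y| ^ (gamma - 1)| ≤ K'' * |x - y| ^ alpha''
  C0 : ℝ
  C0_pos : 0 < C0
  lam : ℝ
  lam_mem : lam ∈ Ioo (0:ℝ) 1
  decay : ∀ ε ∈ Icc 0 eps0, ∀ n : ℕ, 1 ≤ n → ∀ w : List Bool, w.length = n + 1 →
    len (Iw (f ε) w) ≤ C0 * lam ^ n

/-- The domain of the branch of `f` with label `b`. -/
def side : Bool → Set ℝ
  | false => Icc (-1) 0
  | true => Icc 0 1

/-- The interior of `side b`. -/
def openSide : Bool → Set ℝ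
  | false => Ioo (-1) 0
  | true => Ioo 0 1

lemma side_subset (b : Bool) : side b ⊆ Icc (-1) 1 := by
  cases b
  · exact Icc_subset_Icc_right zero_le_one
  · exact Icc_subset_Icc_left (by norm_num)

lemma openSide_subset (b : Bool) : openSide b ⊆ Ioo (-1) 1 := by
  cases b
  · exact Ioo_subset_Ioo_right zero_le_one
  · exact Ioo_subset_Ioo_left (by norm_num)

lemma ne_zero_of_mem_openSide {b : Bool} {x : ℝ} (hx : x ∈ openSide b) : x ≠ 0 := by
  cases b
  · exact hx.2.ne
  · exact hx.1.ne'

lemma uIcc_subset_side {b : Bool} {p q : ℝ} (hp : p ∈ side b) (hq : q ∈ side b) :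
    uIcc p q ⊆ side b := by
  cases b <;> exact uIcc_subset_Icc hp hq

/-- On each side the order of absolute values is controlled by the closer endpoint. -/
lemma min_abs_le_of_mem_uIcc {b : Bool} {p q x : ℝ} (hp : p ∈ side b) (hq : q ∈ side b)
    (hx : x ∈ uIcc p q) : min |p| |q| ≤ |x| := by
  have hxs := uIcc_subset_side hp hq hx
  cases b
  · rw [abs_of_nonpos hp.2, abs_of_nonpos hq.2, abs_of_nonpos hxs.2, min_neg_neg]
    exact neg_le_neg hx.2
  · rw [abs_of_nonneg hp.1, abs_of_nonneg hq.1, abs_of_nonneg hxs.1]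
    exact hx.1

/-- Continuous maps `f` of `[-1, 1]` with two full monotone branches. -/
structure FullUnimodal (f : ℝ → ℝ) : Prop where
  cont : ContinuousOn f (Icc (-1) 1)
  mono : StrictMonoOn f (Icc (-1) 0)
  anti : StrictAntiOn f (Icc 0 1)
  map_neg_one : f (-1) = -1
  map_one : f 1 = -1
  one_le_map_zero : 1 ≤ f 0

/-- The interval `I_w`, given by its endpoints. -/
noncomputable def seg (f : ℝ → ℝ) (w : List Bool) : Set ℝ := uIcc (gw f w (-1)) (gw f w 1)

/-- The length of the interval `I_w`. -/
noncomputable def segLen (f : ℝ → ℝ) (w : List Bool) : ℝ := |gw f w (-1) - gw f w 1|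

lemma gw_append (f : ℝ → ℝ) (v w : List Bool) (x : ℝ) :
    gw f (v ++ w) x = gw f v (gw f w x) := by
  induction v with
  | nil => rfl
  | cons b v ih => simp [gw, ih]

namespace FullUnimodal

lemma surjOn_side {f : ℝ → ℝ} (hf : FullUnimodal f) (b : Bool) :
    SurjOn f (side b) (Icc (-1) 1) := by
  have h0 := hf.one_le_map_zero
  cases b
  · refine Subset.trans ?_ (intermediate_value_Icc (by norm_num)
      (hf.cont.mono (side_subset false)))
    rw [hf.map_neg_one]
    exact Icc_subset_Icc_right h0
  · refine Subset.trans ?_ (intermediate_value_Icc' zero_le_one (hf.cont.mono (side_subset true)))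
    rw [hf.map_one]
    exact Icc_subset_Icc_right h0

lemma branch_mem {f : ℝ → ℝ} (hf : FullUnimodal f) (b : Bool) {x : ℝ} (hx : x ∈ Icc (-1) 1) :
    branch f b x ∈ side b := by
  have h := hf.surjOn_side b hx
  cases b <;> exact Function.invFunOn_mem h

lemma map_branch {f : ℝ → ℝ} (hf : FullUnimodal f) (b : Bool) {x : ℝ} (hx : x ∈ Icc (-1) 1) :
    f (branch f b x) = x := by
  have h := hf.surjOn_side b hx
  cases b <;> exact Function.invFunOn_eq h

lemma injOn_side {f : ℝ → ℝ} (hf : FullUnimodal f) (b : Bool) : InjOn f (side b) := by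
  cases b
  · exact hf.mono.injOn
  · exact hf.anti.injOn

lemma mapsTo_uIcc {f : ℝ → ℝ} (hf : FullUnimodal f) {b : Bool} {p q : ℝ} (hp : p ∈ side b)
    (hq : q ∈ side b) : MapsTo f (uIcc p q) (uIcc (f p) (f q)) := by
  have hs := uIcc_subset_side hp hq
  cases b
  · exact (hf.mono.monotoneOn.mono hs).mapsTo_uIcc
  · exact (hf.anti.antitoneOn.mono hs).mapsTo_uIcc

lemma branch_mem_uIcc {f : ℝ → ℝ} (hf : FullUnimodal f) (b : Bool) {p q x : ℝ}
    (hp : p ∈ Icc (-1) 1) (hq : q ∈ Icc (-1) 1) (hx : x ∈ uIcc p q) :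
    branch f b x ∈ uIcc (branch f b p) (branch f b q) := by
  have hxI : x ∈ Icc (-1 : ℝ) 1 := uIcc_subset_Icc hp hq hx
  have hp' := hf.branch_mem b hp
  have hq' := hf.branch_mem b hq
  have hx' := hf.branch_mem b hxI
  rw [← hf.map_branch b hp, ← hf.map_branch b hq, ← hf.map_branch b hxI] at hx
  rw [mem_uIcc] at hx ⊢
  cases b
  · rwa [hf.mono.le_iff_le hp' hx', hf.mono.le_iff_le hx' hq', hf.mono.le_iff_le hq' hx',
      hf.mono.le_iff_le hx' hp'] at hx
  · rw [hf.anti.le_iff_ge hp' hx', hf.anti.le_iff_ge hx' hq', hf.anti.le_iff_ge hq' hx',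
      hf.anti.le_iff_ge hx' hp'] at hx
    tauto

lemma image_branch_uIcc {f : ℝ → ℝ} (hf : FullUnimodal f) (b : Bool) {p q : ℝ}
    (hp : p ∈ Icc (-1) 1) (hq : q ∈ Icc (-1) 1) :
    branch f b '' uIcc p q = uIcc (branch f b p) (branch f b q) := by
  apply Subset.antisymm
  · rintro _ ⟨x, hx, rfl⟩
    exact hf.branch_mem_uIcc b hp hq hx
  · intro y hy
    have hp' := hf.branch_mem b hp
    have hq' := hf.branch_mem b hq
    have hfy := hf.mapsTo_uIcc hp' hq' hy
    rw [hf.map_branch b hp, hf.map_branch b hq] at hfy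
    have hI := uIcc_subset_Icc hp hq hfy
    exact ⟨f y, hfy, hf.injOn_side b (hf.branch_mem b hI) (uIcc_subset_side hp' hq' hy)
      (hf.map_branch b hI)⟩

lemma gw_mem {f : ℝ → ℝ} (hf : FullUnimodal f) (w : List Bool) {x : ℝ} (hx : x ∈ Icc (-1) 1) :
    gw f w x ∈ Icc (-1) 1 := by
  induction w with
  | nil => exact hx
  | cons b w ih => exact side_subset b (hf.branch_mem b ih)

lemma gw_injOn {f : ℝ → ℝ} (hf : FullUnimodal f) (w : List Bool) :
    InjOn (gw f w) (Icc (-1) 1) := by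
  induction w with
  | nil => exact injOn_id _
  | cons b w ih =>
    intro x hx y hy hxy
    apply ih hx hy
    have := congrArg f hxy
    rwa [gw, Function.comp_apply, Function.comp_apply, hf.map_branch b (hf.gw_mem w hx),
      hf.map_branch b (hf.gw_mem w hy)] at this

lemma gw_neg_one_mem {f : ℝ → ℝ} (hf : FullUnimodal f) (w : List Bool) :
    gw f w (-1) ∈ Icc (-1) 1 := hf.gw_mem w (by norm_num)

lemma gw_one_mem {f : ℝ → ℝ} (hf : FullUnimodal f) (w : List Bool) :
    gw f w 1 ∈ Icc (-1) 1 := hf.gw_mem w (by norm_num)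

lemma Iw_eq {f : ℝ → ℝ} (hf : FullUnimodal f) (w : List Bool) : Iw f w = seg f w := by
  induction w with
  | nil => simp [Iw, seg, gw, uIcc_of_le]
  | cons b w ih =>
    rw [Iw, gw, image_comp]
    change branch f b '' Iw f w = _
    rw [ih, seg, hf.image_branch_uIcc b (hf.gw_neg_one_mem w) (hf.gw_one_mem w)]
    rfl

lemma len_Iw {f : ℝ → ℝ} (hf : FullUnimodal f) (w : List Bool) : len (Iw f w) = segLen f w := by
  rw [hf.Iw_eq, len, seg, Real.volume_interval, ENNReal.toReal_ofReal (abs_nonneg _), segLen,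
    abs_sub_comm]

lemma segLen_pos {f : ℝ → ℝ} (hf : FullUnimodal f) (w : List Bool) : 0 < segLen f w := by
  refine abs_pos.2 (sub_ne_zero.2 fun h => ?_)
  have := hf.gw_injOn w (by norm_num) (by norm_num) h
  norm_num at this

lemma gw_cons_mem {f : ℝ → ℝ} (hf : FullUnimodal f) (b : Bool) (w : List Bool) {x : ℝ}
    (hx : x ∈ Icc (-1) 1) : gw f (b :: w) x ∈ side b :=
  hf.branch_mem b (hf.gw_mem w hx)

lemma map_gw_cons {f : ℝ → ℝ} (hf : FullUnimodal f) (b : Bool) (w : List Bool) {x : ℝ}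
    (hx : x ∈ Icc (-1) 1) : f (gw f (b :: w) x) = gw f w x :=
  hf.map_branch b (hf.gw_mem w hx)

lemma seg_cons_subset {f : ℝ → ℝ} (hf : FullUnimodal f) (b : Bool) (w : List Bool) :
    seg f (b :: w) ⊆ side b :=
  uIcc_subset_side (hf.gw_cons_mem b w (by norm_num)) (hf.gw_cons_mem b w (by norm_num))

lemma mapsTo_seg {f : ℝ → ℝ} (hf : FullUnimodal f) (b : Bool) (w : List Bool) :
    MapsTo f (seg f (b :: w)) (seg f w) := by
  have h := hf.mapsTo_uIcc (hf.gw_cons_mem b w (x := -1) (by norm_num))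
    (hf.gw_cons_mem b w (x := 1) (by norm_num))
  rwa [hf.map_gw_cons b w (by norm_num), hf.map_gw_cons b w (by norm_num)] at h

lemma gw_mem_seg {f : ℝ → ℝ} (hf : FullUnimodal f) (w : List Bool) {x : ℝ} (hx : x ∈ Icc (-1) 1) :
    gw f w x ∈ seg f w := by
  rw [← hf.Iw_eq]
  exact mem_image_of_mem _ hx

lemma gw_replicate_false_neg_one {f : ℝ → ℝ} (hf : FullUnimodal f) (j : ℕ) :
    gw f (List.replicate j false) (-1) = -1 := by
  induction j with
  | zero => rfl
  | succ j ih =>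
    apply hf.injOn_side false (hf.gw_cons_mem false _ (by norm_num)) (by simp [side])
    rw [hf.map_gw_cons false _ (by norm_num), ih, hf.map_neg_one]

/-- The intervals `I_{0^j w}` lie in `I_{0^j}`, which starts at the fixed point `-1`. -/
lemma add_one_le_of_mem_seg_replicate {f : ℝ → ℝ} (hf : FullUnimodal f) (j : ℕ) (w : List Bool)
    {y : ℝ} (hy : y ∈ seg f (List.replicate j false ++ w)) :
    y + 1 ≤ segLen f (List.replicate j false) := by
  rw [segLen, hf.gw_replicate_false_neg_one]
  suffices h : y ≤ gw f (List.replicate j false) 1 by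
    have := neg_le_abs (-1 - gw f (List.replicate j false) 1)
    linarith
  induction j generalizing y with
  | zero => exact (uIcc_subset_Icc (hf.gw_neg_one_mem w) (hf.gw_one_mem w) hy).2
  | succ j ih =>
    rw [List.replicate_succ] at hy ⊢
    rw [List.cons_append] at hy
    rw [← hf.mono.le_iff_le (hf.seg_cons_subset false _ hy)
      (hf.gw_cons_mem false _ (by norm_num)), hf.map_gw_cons false _ (by norm_num)]
    exact ih (hf.mapsTo_seg false _ hy)

end FullUnimodal

/-- The constants that are uniform along a good family. -/
structure Bounds where
  γ : ℝ
  c : ℝ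
  M : ℝ
  K : ℝ
  α : ℝ
  L : ℝ
  lam : ℝ
  one_lt_γ : 1 < γ
  c_pos : 0 < c
  M_pos : 0 < M
  K_pos : 0 < K
  α_pos : 0 < α
  L_pos : 0 < L
  lam_mem : lam ∈ Ioo (0 : ℝ) 1

/-- A full unimodal map with a power law singularity at `0`, with Hölder control of the logarithm
of its derivative away from the singularity and exponentially shrinking partitions. -/
structure Controlled (k : Bounds) (f f' : ℝ → ℝ) : Prop extends FullUnimodal f where
  hasDerivAt : ∀ x ∈ Ioo (-1) 1, HasDerivAt f (f' x) x
  lower : ∀ x ∈ Ioo (-1) 1, x ≠ 0 → k.c * |x| ^ (k.γ - 1) ≤ |f' x|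
  upper : ∀ x ∈ Ioo (-1) 1, x ≠ 0 → |f' x| ≤ k.M * |x| ^ (k.γ - 1)
  distortion : ∀ b, ∀ x ∈ openSide b, ∀ y ∈ openSide b,
    |Real.log (f' x) - Real.log (f' y)| ≤
      k.K * |x - y| ^ k.α + (k.γ - 1) * |Real.log x - Real.log y|
  decay : ∀ w, segLen f w ≤ k.L * k.lam ^ w.length

lemma abs_log_sub_le {x y Q : ℝ} (hx : x ≠ 0) (hy : y ≠ 0) (hxQ : |x - y| ≤ Q * |x|)
    (hyQ : |x - y| ≤ Q * |y|) : |Real.log x - Real.log y| ≤ Q := by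
  have key : ∀ u v : ℝ, u ≠ 0 → v ≠ 0 → |u - v| ≤ Q * |v| → Real.log u - Real.log v ≤ Q := by
    intro u v hu hv h
    have hv' := abs_pos.2 hv
    rw [← Real.log_abs u, ← Real.log_abs v, ← Real.log_div (abs_ne_zero.2 hu) (abs_ne_zero.2 hv)]
    refine (Real.log_le_sub_one_of_pos (by positivity)).trans ?_
    rw [sub_le_iff_le_add, div_le_iff₀ hv']
    linarith [abs_sub_abs_le_abs_sub u v]
  rw [abs_le]
  constructor
  · have := key y x hy hx (by rwa [abs_sub_comm])
    linarith
  · exact key x y hx hy hyQ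

lemma abs_sub_le_segLen {f : ℝ → ℝ} {w : List Bool} {x y : ℝ} (hx : x ∈ seg f w)
    (hy : y ∈ seg f w) : |x - y| ≤ segLen f w :=
  Real.dist_le_of_mem_uIcc hx hy

namespace Bounds

/-- The bound for the variation of `log |f'|` over a set of diameter `t` that lies
at distance at least `1 / M` from the critical point. -/
noncomputable def var (k : Bounds) (t : ℝ) : ℝ := k.K * t ^ k.α + (k.γ - 1) * (k.M * t)

lemma var_nonneg (k : Bounds) {t : ℝ} (ht : 0 ≤ t) : 0 ≤ k.var t := by
  have := k.one_lt_γ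
  have := k.K_pos
  have := k.M_pos
  have : 0 ≤ k.γ - 1 := by linarith
  unfold var
  positivity

lemma summable_pow (k : Bounds) : Summable fun i : ℕ => k.lam ^ i :=
  summable_geometric_of_lt_one k.lam_mem.1.le k.lam_mem.2

lemma summable_rpow (k : Bounds) : Summable fun i : ℕ => (k.L * k.lam ^ i) ^ k.α := by
  have h0 := k.lam_mem.1
  have h : ∀ i : ℕ, (k.L * k.lam ^ i) ^ k.α = k.L ^ k.α * (k.lam ^ k.α) ^ i := fun i => by
    rw [Real.mul_rpow k.L_pos.le (by positivity), ← Real.rpow_natCast, ← Real.rpow_natCast,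
      ← Real.rpow_mul h0.le, ← Real.rpow_mul h0.le, mul_comm (i : ℝ)]
  simp_rw [h]
  exact (summable_geometric_of_lt_one (by positivity)
    (Real.rpow_lt_one h0.le k.lam_mem.2 k.α_pos)).mul_left _

lemma summable_var (k : Bounds) : Summable fun i : ℕ => k.var (k.L * k.lam ^ i) :=
  (k.summable_rpow.mul_left _).add (((k.summable_pow.mul_left _).mul_left _).mul_left _)

lemma pow_le_pow (k : Bounds) {m n : ℕ} (h : m ≤ n) : k.lam ^ n ≤ k.lam ^ m :=
  pow_le_pow_of_le_one k.lam_mem.1.le k.lam_mem.2.le h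

/-- The lower bound for `|f'|` where `f ≤ 0`. -/
noncomputable def c' (k : Bounds) : ℝ := k.c * (1 / k.M) ^ (k.γ - 1)

lemma c'_pos (k : Bounds) : 0 < k.c' := by
  have := k.c_pos
  have := k.M_pos
  unfold c'
  positivity

/-- The bound for the relative size of intervals near `-1`. -/
noncomputable def leftConst (k : Bounds) : ℝ :=
  k.L * (1 + k.M) * Real.exp (∑' i : ℕ, k.var (k.L * k.lam ^ i))

lemma leftConst_pos (k : Bounds) : 0 < k.leftConst := by
  have := k.L_pos
  have := k.M_pos
  unfold leftConst
  positivity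

/-- The bound for the relative size of intervals near `1`. -/
noncomputable def rightConst (k : Bounds) : ℝ := k.L * k.M + k.leftConst * k.M / k.c'

lemma rightConst_pos (k : Bounds) : 0 < k.rightConst := by
  have := k.L_pos
  have := k.M_pos
  have := k.leftConst_pos
  have := k.c'_pos
  unfold rightConst
  positivity

/-- The bound for the relative size of intervals near `0`. -/
noncomputable def centerConst (k : Bounds) : ℝ := k.M * k.L + k.M / k.c * k.rightConst

lemma centerConst_pos (k : Bounds) : 0 < k.centerConst := by
  have := k.L_pos
  have := k.M_pos
  have := k.c_pos
  have := k.rightConst_pos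
  unfold centerConst
  positivity

end Bounds

namespace Controlled

lemma exists_slope {k : Bounds} {f f' : ℝ → ℝ} (hf : Controlled k f f') {b : Bool} {p q : ℝ}
    (hp : p ∈ side b) (hq : q ∈ side b) (hpq : p ≠ q) :
    ∃ ξ ∈ openSide b, ξ ∈ Ioo (min p q) (max p q) ∧ |f p - f q| = |f' ξ| * |p - q| := by
  wlog h : p < q generalizing p q
  · have := this hq hp hpq.symm (lt_of_le_of_ne (not_lt.1 h) hpq.symm)
    rwa [min_comm, max_comm, abs_sub_comm, abs_sub_comm p]
  have hsub : Ioo p q ⊆ openSide b := by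
    cases b
    · exact Ioo_subset_Ioo hp.1 hq.2
    · exact Ioo_subset_Ioo hp.1 hq.2
  have hIcc : Icc p q ⊆ Icc (-1) 1 := by
    rw [← uIcc_of_le h.le]
    exact (uIcc_subset_side hp hq).trans (side_subset b)
  obtain ⟨ξ, hξ, hs⟩ := exists_hasDerivAt_eq_slope f f' h (hf.cont.mono hIcc)
    fun x hx => hf.hasDerivAt x (openSide_subset b (hsub hx))
  refine ⟨ξ, hsub hξ, by rwa [min_eq_left h.le, max_eq_right h.le], ?_⟩
  rw [abs_sub_comm, abs_sub_comm p, ← abs_mul, hs, div_mul_cancel₀ _ (sub_pos.2 h).ne']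

lemma abs_deriv_pos {k : Bounds} {f f' : ℝ → ℝ} (hf : Controlled k f f') {b : Bool} {x : ℝ}
    (hx : x ∈ openSide b) : 0 < |f' x| := by
  have hx0 := ne_zero_of_mem_openSide hx
  have := abs_pos.2 hx0
  have := k.c_pos
  exact lt_of_lt_of_le (by positivity) (hf.lower x (openSide_subset b hx) hx0)

lemma abs_deriv_le {k : Bounds} {f f' : ℝ → ℝ} (hf : Controlled k f f') {b : Bool} {x : ℝ}
    (hx : x ∈ openSide b) : |f' x| ≤ k.M := by
  have hxI := openSide_subset b hx
  refine (hf.upper x hxI (ne_zero_of_mem_openSide hx)).trans ?_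
  have h1 : |x| ≤ 1 := abs_le.2 ⟨hxI.1.le, hxI.2.le⟩
  have := k.one_lt_γ
  exact mul_le_of_le_one_right k.M_pos.le (Real.rpow_le_one (abs_nonneg _) h1 (by linarith))

lemma lipschitz {k : Bounds} {f f' : ℝ → ℝ} (hf : Controlled k f f') {b : Bool} {p q : ℝ}
    (hp : p ∈ side b) (hq : q ∈ side b) : |f p - f q| ≤ k.M * |p - q| := by
  rcases eq_or_ne p q with rfl | hpq
  · simp
  · obtain ⟨ξ, hξ, -, h⟩ := hf.exists_slope hp hq hpq
    rw [h]
    exact mul_le_mul_of_nonneg_right (hf.abs_deriv_le hξ) (abs_nonneg _)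

lemma one_le_of_map_nonpos {k : Bounds} {f f' : ℝ → ℝ} (hf : Controlled k f f') {b : Bool} {y : ℝ}
    (hy : y ∈ side b) (h : f y ≤ 0) : 1 ≤ k.M * |y| := by
  have h0 : (0 : ℝ) ∈ side b := by cases b <;> simp [side]
  have h1 := hf.lipschitz h0 hy
  rw [zero_sub, abs_neg] at h1
  linarith [le_abs_self (f 0 - f y), hf.one_le_map_zero]

lemma c'_le_of_map_nonpos {k : Bounds} {f f' : ℝ → ℝ} (hf : Controlled k f f') {b : Bool} {y : ℝ}
    (hy : y ∈ openSide b) (hy' : y ∈ side b) (h : f y ≤ 0) : k.c' ≤ |f' y| := by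
  refine le_trans ?_ (hf.lower y (openSide_subset b hy) (ne_zero_of_mem_openSide hy))
  have hM := k.M_pos
  have := k.one_lt_γ
  have h1 : 1 / k.M ≤ |y| := by
    rw [div_le_iff₀ hM]
    linarith [hf.one_le_of_map_nonpos hy' h]
  exact mul_le_mul_of_nonneg_left (Real.rpow_le_rpow (by positivity) h1 (by linarith)) k.c_pos.le

lemma exists_segLen_eq {k : Bounds} {f f' : ℝ → ℝ} (hf : Controlled k f f') (b : Bool)
    (w : List Bool) :
    ∃ ξ ∈ openSide b, ξ ∈ seg f (b :: w) ∧ segLen f w = |f' ξ| * segLen f (b :: w) := by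
  have hne : gw f (b :: w) (-1) ≠ gw f (b :: w) 1 := sub_ne_zero.1
    (abs_pos.1 (hf.segLen_pos (b :: w)))
  obtain ⟨ξ, hξ, hm, h⟩ := hf.exists_slope (hf.gw_cons_mem b w (x := -1) (by norm_num))
    (hf.gw_cons_mem b w (x := 1) (by norm_num)) hne
  refine ⟨ξ, hξ, Ioo_subset_Icc_self hm, ?_⟩
  rwa [hf.map_gw_cons b w (by norm_num), hf.map_gw_cons b w (by norm_num)] at h

lemma segLen_le {k : Bounds} {f f' : ℝ → ℝ} (hf : Controlled k f f') {w : List Bool} {n : ℕ}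
    (h : n ≤ w.length) : segLen f w ≤ k.L * k.lam ^ n :=
  (hf.decay w).trans (mul_le_mul_of_nonneg_left (k.pow_le_pow h) k.L_pos.le)

/-- Pulling back along the branch fixing `-1` distorts the length relative to the distance from
`-1` only by the variation of `log |f'|`. -/
lemma segLen_false_false_le {k : Bounds} {f f' : ℝ → ℝ} (hf : Controlled k f f') {w : List Bool}
    {S t : ℝ} (hS : 0 ≤ S) (ht : ∀ y ∈ seg f (false :: false :: w), y + 1 ≤ t)
    (h : ∀ x ∈ seg f (false :: w), segLen f (false :: w) ≤ S * (x + 1)) :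
    ∀ y ∈ seg f (false :: false :: w),
      segLen f (false :: false :: w) ≤ S * Real.exp (k.var t) * (y + 1) := by
  intro y hy
  have hys := hf.seg_cons_subset false _ hy
  have hfy := hf.mapsTo_seg false _ hy
  have hmap : ∀ z ∈ seg f (false :: false :: w), f z ≤ 0 := fun z hz =>
    (hf.seg_cons_subset false _ (hf.mapsTo_seg false _ hz)).2
  have hpos := hf.segLen_pos (false :: w)
  obtain ⟨ξ, hξ, hξm, hlen⟩ := hf.exists_segLen_eq false (false :: w)
  have hy1 : -1 ≠ y := by
    rintro rfl
    have := h _ hfy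
    rw [hf.map_neg_one] at this
    linarith
  obtain ⟨ζ, hζ, hζm, hslope⟩ := hf.exists_slope (b := false) (p := -1) (by simp [side]) hys hy1
  rw [min_eq_left hys.1, max_eq_right hys.1] at hζm
  have hy0 : 0 < y + 1 := by linarith [hζm.1, hζm.2]
  have hslope' : f y + 1 = |f' ζ| * (y + 1) := by
    have h1 : -1 ≤ f y := (hf.seg_cons_subset false _ hfy).1
    rw [hf.map_neg_one, abs_of_nonpos (by linarith : -1 - f y ≤ 0),
      abs_of_nonpos (by linarith : -1 - y ≤ 0)] at hslope
    linarith
  have hyM := hf.one_le_of_map_nonpos hys (hmap y hy)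
  have hξM := hf.one_le_of_map_nonpos (hf.seg_cons_subset false _ hξm) (hmap ξ hξm)
  have hM := k.M_pos
  have hζM : 1 ≤ k.M * |ζ| := hyM.trans (mul_le_mul_of_nonneg_left (by
    rw [abs_of_nonpos hys.2, abs_of_nonpos hζ.2.le]; linarith [hζm.2]) hM.le)
  have hdist : |ζ - ξ| ≤ t := by
    have := ht y hy
    have := ht ξ hξm
    have := hξ.1
    rw [abs_le]
    constructor <;> linarith [hζm.1, hζm.2]
  have ht0 : 0 ≤ t := (abs_nonneg _).trans hdist
  have hlog : |Real.log ζ - Real.log ξ| ≤ k.M * t := by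
    apply abs_log_sub_le (ne_zero_of_mem_openSide hζ) (ne_zero_of_mem_openSide hξ)
    · nlinarith
    · nlinarith
  have hvar : Real.log (f' ζ) - Real.log (f' ξ) ≤ k.var t := by
    refine (le_abs_self _).trans ((hf.distortion false ζ hζ ξ hξ).trans ?_)
    have := k.one_lt_γ
    exact add_le_add (mul_le_mul_of_nonneg_left
      (Real.rpow_le_rpow (abs_nonneg _) hdist k.α_pos.le) k.K_pos.le)
      (mul_le_mul_of_nonneg_left hlog (by linarith))
  have hζp := hf.abs_deriv_pos hζ
  have hξp := hf.abs_deriv_pos hξ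
  have hexp : |f' ζ| ≤ Real.exp (k.var t) * |f' ξ| := by
    rw [← div_le_iff₀ hξp, ← Real.log_le_iff_le_exp (by positivity),
      Real.log_div hζp.ne' hξp.ne', Real.log_abs, Real.log_abs]
    exact hvar
  have h1 := h _ hfy
  rw [hlen, hslope'] at h1
  refine le_of_mul_le_mul_left (h1.trans ?_) hξp
  calc S * (|f' ζ| * (y + 1)) ≤ S * ((Real.exp (k.var t) * |f' ξ|) * (y + 1)) := by gcongr
    _ = |f' ξ| * (S * Real.exp (k.var t) * (y + 1)) := by ring

lemma segLen_replicate_le_sum {k : Bounds} {f f' : ℝ → ℝ} (hf : Controlled k f f') (u : List Bool)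
    (j : ℕ) : ∀ x ∈ seg f (List.replicate j false ++ true :: u),
      segLen f (List.replicate j false ++ true :: u) ≤
        k.L * (1 + k.M) * k.lam ^ u.length *
          Real.exp (∑ i ∈ Finset.range (j + 1), k.var (k.L * k.lam ^ i)) * (x + 1) := by
  have hL := k.L_pos
  have hM := k.M_pos
  have hlam := k.lam_mem.1
  have hsum : ∀ j, 1 ≤ Real.exp (∑ i ∈ Finset.range (j + 1), k.var (k.L * k.lam ^ i)) := fun j =>
    Real.one_le_exp (Finset.sum_nonneg fun i _ => k.var_nonneg (by positivity))
  have start : ∀ (j : ℕ) (w : List Bool) (x : ℝ), u.length ≤ w.length → 1 ≤ (1 + k.M) * (x + 1) →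
      segLen f w ≤ k.L * (1 + k.M) * k.lam ^ u.length *
          Real.exp (∑ i ∈ Finset.range (j + 1), k.var (k.L * k.lam ^ i)) * (x + 1) := by
    intro j w x hw hx
    calc segLen f w ≤ k.L * k.lam ^ u.length * 1 * 1 := by
          rw [mul_one, mul_one]; exact hf.segLen_le hw
      _ ≤ k.L * k.lam ^ u.length *
          Real.exp (∑ i ∈ Finset.range (j + 1), k.var (k.L * k.lam ^ i)) *
          ((1 + k.M) * (x + 1)) := by gcongr; exact hsum j
      _ = _ := by ring
  induction j with
  | zero =>
    intro x hx
    have hx0 : 0 ≤ x := (hf.seg_cons_subset true u hx).1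
    exact start 0 _ x (by simp) (by nlinarith)
  | succ j ih =>
    cases j with
    | zero =>
      intro x hx
      have hxs := hf.seg_cons_subset false (true :: u) hx
      have hfx : 0 ≤ f x := (hf.seg_cons_subset true u (hf.mapsTo_seg false (true :: u) hx)).1
      have h := hf.lipschitz (b := false) hxs (q := -1) (by simp [side])
      rw [hf.map_neg_one, sub_neg_eq_add, sub_neg_eq_add] at h
      rw [abs_of_nonneg (by linarith), abs_of_nonneg (by linarith [hxs.1])] at h
      exact start 1 _ x (by simp; omega) (by nlinarith [hxs.1])
    | succ j =>
      intro x hx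
      have hstep := hf.segLen_false_false_le (w := List.replicate j false ++ true :: u)
        (t := k.L * k.lam ^ (j + 2)) ?_ ?_ ih x hx
      · rw [Finset.sum_range_succ, Real.exp_add, ← mul_assoc]
        exact hstep
      · positivity
      · intro y hy
        refine (hf.add_one_le_of_mem_seg_replicate (j + 2) (true :: u) hy).trans ?_
        exact hf.segLen_le (by simp)

lemma segLen_replicate_le {k : Bounds} {f f' : ℝ → ℝ} (hf : Controlled k f f') (u : List Bool)
    (j : ℕ) : ∀ x ∈ seg f (List.replicate j false ++ true :: u),
      segLen f (List.replicate j false ++ true :: u) ≤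
        k.leftConst * k.lam ^ u.length * (x + 1) := by
  intro x hx
  have hL := k.L_pos
  have hM := k.M_pos
  have hlam := k.lam_mem.1
  have hx1 : 0 ≤ x + 1 := by
    have := (uIcc_subset_Icc (hf.gw_neg_one_mem _) (hf.gw_one_mem _) hx).1
    linarith
  refine (hf.segLen_replicate_le_sum u j x hx).trans ?_
  have hs : ∑ i ∈ Finset.range (j + 1), k.var (k.L * k.lam ^ i) ≤
      ∑' i : ℕ, k.var (k.L * k.lam ^ i) :=
    k.summable_var.sum_le_tsum _ fun i _ => k.var_nonneg (by positivity)
  rw [Bounds.leftConst, mul_right_comm (k.L * (1 + k.M)) (Real.exp _)]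
  gcongr

/-- Relative size near the turning value `1`. -/
lemma segLen_true_le {k : Bounds} {f f' : ℝ → ℝ} (hf : Controlled k f f') (u : List Bool)
    (j : ℕ) : ∀ y ∈ seg f (true :: (List.replicate j false ++ true :: u)),
      segLen f (true :: (List.replicate j false ++ true :: u)) ≤
        k.rightConst * k.lam ^ u.length * (1 - y) := by
  intro y hy
  have hys := hf.seg_cons_subset true _ hy
  have hfy := hf.mapsTo_seg true _ hy
  have hL := k.L_pos
  have hM := k.M_pos
  have hlam := k.lam_mem.1
  have hC := k.leftConst_pos
  have hc := k.c'_pos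
  have hlip := hf.lipschitz (b := true) hys (q := 1) (by simp [side])
  rw [hf.map_one, sub_neg_eq_add, abs_sub_comm y, abs_of_nonneg (sub_nonneg.2 hys.2)] at hlip
  replace hlip := (le_abs_self _).trans hlip
  have hy1 : 0 ≤ 1 - y := sub_nonneg.2 hys.2
  rw [Bounds.rightConst, add_mul, add_mul]
  cases j with
  | zero =>
    have h0 : 0 ≤ f y := (hf.seg_cons_subset true u hfy).1
    have h1 : segLen f (true :: true :: u) ≤ k.L * k.lam ^ u.length :=
      hf.segLen_le (by simp; omega)
    have h2 : k.L * k.lam ^ u.length * 1 ≤ k.L * k.lam ^ u.length * (k.M * (1 - y)) := by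
      gcongr; linarith
    have h3 : 0 ≤ k.leftConst * k.M / k.c' * k.lam ^ u.length * (1 - y) := by positivity
    change segLen f (true :: true :: u) ≤ _
    linarith
  | succ j =>
    obtain ⟨ξ, hξ, hξm, hlen⟩ :=
      hf.exists_segLen_eq true (List.replicate (j + 1) false ++ true :: u)
    have hfξ : f ξ ≤ 0 := (hf.seg_cons_subset false _ (hf.mapsTo_seg true _ hξm)).2
    have hlow := hf.c'_le_of_map_nonpos hξ (hf.seg_cons_subset true _ hξm) hfξ
    have hleft := hf.segLen_replicate_le u (j + 1) _ hfy
    have hp := hf.segLen_pos (true :: (List.replicate (j + 1) false ++ true :: u))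
    have h1 : k.c' * segLen f (true :: (List.replicate (j + 1) false ++ true :: u)) ≤
        k.leftConst * k.lam ^ u.length * (k.M * (1 - y)) := by
      calc _ ≤ |f' ξ| * segLen f (true :: (List.replicate (j + 1) false ++ true :: u)) := by gcongr
        _ ≤ k.leftConst * k.lam ^ u.length * (f y + 1) := hlen ▸ hleft
        _ ≤ _ := by gcongr
    have h2 : 0 ≤ k.L * k.M * k.lam ^ u.length * (1 - y) := by positivity
    rw [← le_div_iff₀' hc] at h1
    have h3 : k.leftConst * k.lam ^ u.length * (k.M * (1 - y)) / k.c' =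
      k.leftConst * k.M / k.c' * k.lam ^ u.length * (1 - y) := by ring
    linarith

/-- The relative size with respect to the turning value controls the relative size of the
preimages with respect to the critical point. -/
lemma segLen_cons_le_of_turning {k : Bounds} {f f' : ℝ → ℝ} (hf : Controlled k f f') (b : Bool)
    {w : List Bool} {S : ℝ} (hS : 0 ≤ S) (h : ∀ x ∈ seg f w, segLen f w ≤ S * (1 - x)) :
    ∀ y ∈ seg f (b :: w), segLen f (b :: w) ≤ k.M / k.c * S * |y| := by
  intro y hy
  have hc := k.c_pos
  have hM := k.M_pos
  have hγ : 0 ≤ k.γ - 1 := by linarith [k.one_lt_γ]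
  have hp := hf.gw_cons_mem b w (x := -1) (by norm_num)
  have hq := hf.gw_cons_mem b w (x := 1) (by norm_num)
  obtain ⟨z, hz, hzmin⟩ : ∃ z ∈ seg f (b :: w), ∀ x ∈ seg f (b :: w), |z| ≤ |x| := by
    rcases min_choice |gw f (b :: w) (-1)| |gw f (b :: w) 1| with hm | hm
    · exact ⟨_, left_mem_uIcc, fun x hx => hm ▸ min_abs_le_of_mem_uIcc hp hq hx⟩
    · exact ⟨_, right_mem_uIcc, fun x hx => hm ▸ min_abs_le_of_mem_uIcc hp hq hx⟩
  have hzs := hf.seg_cons_subset b w hz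
  have hlenw := hf.segLen_pos w
  have hz1 := h _ (hf.mapsTo_seg b w hz)
  have h0 : (0 : ℝ) ∈ side b := by cases b <;> simp [side]
  have hz0 : 0 ≠ z := by
    rintro rfl
    have := mul_nonneg hS (sub_nonneg.2 hf.one_le_map_zero)
    linarith
  obtain ⟨ξ, hξ, hξm, hlen⟩ := hf.exists_segLen_eq b w
  obtain ⟨ζ, hζ, hζm, hslope⟩ := hf.exists_slope h0 hzs hz0
  have hζz : |ζ| ≤ |z| := by
    cases b
    · rw [abs_of_nonpos hζ.2.le, abs_of_nonpos hzs.2]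
      rw [min_eq_right hzs.2] at hζm
      linarith [hζm.1]
    · rw [abs_of_nonneg hζ.1.le, abs_of_nonneg hzs.1]
      rw [max_eq_right hzs.1] at hζm
      exact hζm.2.le
  have hzpos : 0 < |z| := abs_pos.2 hz0.symm
  set T := |z| ^ (k.γ - 1) with hT
  have hTpos : 0 < T := by positivity
  have hup : 1 - f z ≤ k.M * T * |z| := by
    have h1 : f 0 - f z ≤ |f' ζ| * |0 - z| := hslope ▸ le_abs_self _
    rw [zero_sub, abs_neg] at h1
    have h2 : |f' ζ| ≤ k.M * T :=
      (hf.upper ζ (openSide_subset b hζ) (ne_zero_of_mem_openSide hζ)).trans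
        (mul_le_mul_of_nonneg_left (Real.rpow_le_rpow (abs_nonneg _) hζz hγ) hM.le)
    have h3 := mul_le_mul_of_nonneg_right h2 hzpos.le
    linarith [hf.one_le_map_zero]
  have hlow : k.c * T ≤ |f' ξ| :=
    (mul_le_mul_of_nonneg_left (Real.rpow_le_rpow (abs_nonneg _) (hzmin ξ hξm) hγ) hc.le).trans
      (hf.lower ξ (openSide_subset b hξ) (ne_zero_of_mem_openSide hξ))
  have hpos := hf.segLen_pos (b :: w)
  have hchain : k.c * T * segLen f (b :: w) ≤ k.c * T * (k.M / k.c * S * |z|) := by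
    calc k.c * T * segLen f (b :: w) ≤ |f' ξ| * segLen f (b :: w) := by gcongr
      _ ≤ S * (1 - f z) := hlen ▸ hz1
      _ ≤ S * (k.M * T * |z|) := by gcongr
      _ = k.c * T * (k.M / k.c * S * |z|) := by field_simp
  refine (le_of_mul_le_mul_left hchain (by positivity)).trans ?_
  have := hzmin y hy
  gcongr

lemma segLen_cons_true_le {k : Bounds} {f f' : ℝ → ℝ} (hf : Controlled k f f') (b : Bool)
    (u : List Bool) (j : ℕ) :
    ∀ y ∈ seg f (b :: true :: (List.replicate j false ++ true :: u)),
      segLen f (b :: true :: (List.replicate j false ++ true :: u)) ≤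
        k.centerConst * k.lam ^ u.length * |y| := by
  intro y hy
  have hlam := k.lam_mem.1
  have hA := k.rightConst_pos
  refine (hf.segLen_cons_le_of_turning b (by positivity) (hf.segLen_true_le u j) y hy).trans ?_
  have := k.L_pos
  have := k.M_pos
  rw [← mul_assoc]
  gcongr
  exact le_add_of_nonneg_left (by positivity)

lemma segLen_cons_false_le {k : Bounds} {f f' : ℝ → ℝ} (hf : Controlled k f f') (b : Bool)
    (u : List Bool) : ∀ y ∈ seg f (b :: false :: u),
      segLen f (b :: false :: u) ≤ k.centerConst * k.lam ^ u.length * |y| := by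
  intro y hy
  have hlam := k.lam_mem.1
  have hL := k.L_pos
  have hM := k.M_pos
  have hc := k.c_pos
  have hA := k.rightConst_pos
  have h1 := hf.one_le_of_map_nonpos (hf.seg_cons_subset b _ hy)
    (hf.seg_cons_subset false _ (hf.mapsTo_seg b _ hy)).2
  calc segLen f (b :: false :: u) ≤ k.L * k.lam ^ u.length * 1 := by
        rw [mul_one]; exact hf.segLen_le (by simp; omega)
    _ ≤ k.L * k.lam ^ u.length * (k.M * |y|) := by gcongr
    _ = k.M * k.L * k.lam ^ u.length * |y| := by ring
    _ ≤ _ := by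
      gcongr
      exact le_add_of_nonneg_right (by positivity)

end Controlled

/-- The ratio of `|I_{wb}|` to `|I_w|`. -/
noncomputable def segRatio (f : ℝ → ℝ) (w : List Bool) (b : Bool) : ℝ :=
  segLen f (w ++ [b]) / segLen f w

namespace FullUnimodal

lemma seg_append_subset {f : ℝ → ℝ} (hf : FullUnimodal f) (w : List Bool) (b : Bool) :
    seg f (w ++ [b]) ⊆ seg f w := by
  rw [seg, gw_append, gw_append]
  exact uIcc_subset_uIcc (hf.gw_mem_seg w (hf.gw_neg_one_mem [b]))
    (hf.gw_mem_seg w (hf.gw_one_mem [b]))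

lemma segRatio_pos {f : ℝ → ℝ} (hf : FullUnimodal f) (w : List Bool) (b : Bool) :
    0 < segRatio f w b :=
  div_pos (hf.segLen_pos _) (hf.segLen_pos _)

lemma segRatio_le_one {f : ℝ → ℝ} (hf : FullUnimodal f) (w : List Bool) (b : Bool) :
    segRatio f w b ≤ 1 :=
  div_le_one_of_le₀ (abs_sub_le_segLen (hf.seg_append_subset w b left_mem_uIcc)
    (hf.seg_append_subset w b right_mem_uIcc)) (hf.segLen_pos w).le

end FullUnimodal

lemma abs_sub_le_abs_log_sub {x y : ℝ} (hx : 0 < x) (hx1 : x ≤ 1) (hy : 0 < y) (hy1 : y ≤ 1) :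
    |x - y| ≤ |Real.log x - Real.log y| := by
  wlog h : x ≤ y generalizing x y
  · rw [abs_sub_comm, abs_sub_comm (Real.log x)]
    exact this hy hy1 hx hx1 (le_of_not_ge h)
  have h1 := Real.one_sub_inv_le_log_of_pos (div_pos hy hx)
  rw [Real.log_div hy.ne' hx.ne', inv_div] at h1
  have h2 : y - x ≤ 1 - x / y := by
    rw [one_sub_div hy.ne', le_div_iff₀ hy]
    nlinarith
  rw [abs_sub_comm, abs_of_nonneg (sub_nonneg.2 h), abs_sub_comm]
  exact (h2.trans h1).trans (le_abs_self _)

lemma Controlled.abs_segRatio_sub_le {k : Bounds} {f f' : ℝ → ℝ} (hf : Controlled k f f')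
    (c b : Bool) {w : List Bool} {Q : ℝ}
    (hQ : ∀ y ∈ seg f (c :: w), segLen f (c :: w) ≤ Q * |y|) :
    |segRatio f w b - segRatio f (c :: w) b| ≤
      k.K * segLen f (c :: w) ^ k.α + (k.γ - 1) * Q := by
  refine (abs_sub_le_abs_log_sub (hf.segRatio_pos w b) (hf.segRatio_le_one w b)
    (hf.segRatio_pos _ b) (hf.segRatio_le_one _ b)).trans ?_
  obtain ⟨ξ, hξ, hξm, hlenξ⟩ := hf.exists_segLen_eq c (w ++ [b])
  obtain ⟨η, hη, hηm, hlenη⟩ := hf.exists_segLen_eq c w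
  have hξm' : ξ ∈ seg f (c :: w) := hf.seg_append_subset (c :: w) b hξm
  have hdist : |ξ - η| ≤ segLen f (c :: w) := abs_sub_le_segLen hξm' hηm
  have hlog : |Real.log ξ - Real.log η| ≤ Q :=
    abs_log_sub_le (ne_zero_of_mem_openSide hξ) (ne_zero_of_mem_openSide hη)
      (hdist.trans (hQ ξ hξm')) (hdist.trans (hQ η hηm))
  have heq : Real.log (segRatio f w b) - Real.log (segRatio f (c :: w) b) =
      Real.log (f' ξ) - Real.log (f' η) := by
    rw [segRatio, segRatio, hlenξ, hlenη, List.cons_append]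
    have h1 := (hf.segLen_pos (c :: (w ++ [b]))).ne'
    have h2 := (hf.segLen_pos (c :: w)).ne'
    have h3 := (hf.abs_deriv_pos hξ).ne'
    have h4 := (hf.abs_deriv_pos hη).ne'
    rw [Real.log_div (mul_ne_zero h3 h1) (mul_ne_zero h4 h2), Real.log_div h1 h2,
      Real.log_mul h3 h1, Real.log_mul h4 h2, Real.log_abs, Real.log_abs]
    ring
  rw [heq]
  have := k.one_lt_γ
  exact (hf.distortion c ξ hξ η hη).trans (add_le_add (mul_le_mul_of_nonneg_left
    (Real.rpow_le_rpow (abs_nonneg _) hdist k.α_pos.le) k.K_pos.le)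
    (mul_le_mul_of_nonneg_left hlog (by linarith)))

/-- The word `c_{n-1} ⋯ c_0`. -/
def past (c : ℕ → Bool) : ℕ → List Bool
  | 0 => []
  | n + 1 => c n :: past c n

lemma length_past (c : ℕ → Bool) (n : ℕ) : (past c n).length = n := by
  induction n with
  | zero => rfl
  | succ n ih => simp [past, ih]

lemma past_succ_eq_append (a : ℕ → Bool) (n : ℕ) :
    past a (n + 1) = past (fun i => a (i + 1)) n ++ [a 0] := by
  induction n with
  | zero => rfl
  | succ n ih => rw [past, ih]; rfl

lemma word_eq_past (a : ℕ → Bool) (n : ℕ) : word a n = past a (n + 1) := by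
  have h : ∀ m, ((List.range m).reverse).map a = past a m := by
    intro m
    induction m with
    | zero => rfl
    | succ m ih => rw [List.range_succ]; simp [past, ← ih]
  exact h (n + 1)

lemma FullUnimodal.ratio_eq {f : ℝ → ℝ} (hf : FullUnimodal f) (a : ℕ → Bool) (n : ℕ) :
    ratio f a n = segRatio f (past (fun i => a (i + 1)) n) (a 0) := by
  rw [ratio, hf.len_Iw, hf.len_Iw, word_eq_past, past_succ_eq_append, List.dropLast_concat]
  rfl

/-- `r ^ k` for the last index `k < n` with `c k = true`. -/
noncomputable def lastWeight (r : ℝ) (c : ℕ → Bool) : ℕ → ℝ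
  | 0 => 1
  | n + 1 => bif c n then r ^ n else lastWeight r c n

lemma lastWeight_nonneg {r : ℝ} (hr : 0 ≤ r) (c : ℕ → Bool) (n : ℕ) : 0 ≤ lastWeight r c n := by
  induction n with
  | zero => exact zero_le_one
  | succ n ih =>
    rw [lastWeight]
    cases c n
    · exact ih
    · exact pow_nonneg hr n

lemma exists_past_eq (r : ℝ) (c : ℕ → Bool) (n : ℕ) (h : ∃ i < n, c i = true) :
    ∃ j m, past c n = List.replicate j false ++ true :: past c m ∧ lastWeight r c n = r ^ m := by
  induction n with
  | zero => simp at h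
  | succ n ih =>
    cases hc : c n
    · obtain ⟨i, hi, hci⟩ := h
      have hin : i < n := by
        refine lt_of_le_of_ne (Nat.lt_succ_iff.1 hi) ?_
        rintro rfl
        simp [hc] at hci
      obtain ⟨j, m, h1, h2⟩ := ih ⟨i, hin, hci⟩
      exact ⟨j + 1, m, by rw [past, hc, h1]; rfl, by rw [lastWeight, hc]; exact h2⟩
    · exact ⟨0, n, by rw [past, hc]; rfl, by rw [lastWeight, hc]; rfl⟩

/-- The distortion rate along the sequence `c`: a passage through the turning value at time `n`
costs as much as the length of the interval at the previous passage. -/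
noncomputable def rate (r : ℝ) (c : ℕ → Bool) (n : ℕ) : ℝ :=
  r ^ n + bif c n then lastWeight r c n else 0

lemma summable_rate {r : ℝ} (hr : 0 ≤ r) (hr1 : r < 1) (c : ℕ → Bool) : Summable (rate r c) := by
  have hgeom := summable_geometric_of_lt_one hr hr1
  refine hgeom.add (summable_of_sum_range_le (c := 1 + ∑' i, r ^ i) ?_ ?_)
  · intro n
    cases c n
    · exact le_rfl
    · exact lastWeight_nonneg hr c n
  · intro n
    have key : (∑ i ∈ Finset.range n, bif c i then lastWeight r c i else 0) + lastWeight r c n ≤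
        1 + ∑ i ∈ Finset.range n, r ^ i := by
      induction n with
      | zero => simp [lastWeight]
      | succ n ih =>
        rw [Finset.sum_range_succ, Finset.sum_range_succ, lastWeight]
        have := pow_nonneg hr n
        cases c n
        · simp only [cond_false]
          linarith
        · simp only [cond_true]
          linarith
    have h1 := lastWeight_nonneg hr c n
    have h2 := hgeom.sum_le_tsum (Finset.range n) fun i _ => pow_nonneg hr i
    linarith

lemma Controlled.abs_segRatio_past_sub_le {k : Bounds} {f f' : ℝ → ℝ} (hf : Controlled k f f')
    (c : ℕ → Bool) (b : Bool) {n : ℕ} (h : c n = true → ∃ i < n, c i = true) :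
    |segRatio f (past c (n + 1)) b - segRatio f (past c (n + 2)) b| ≤
      k.K * (k.L * k.lam ^ n) ^ k.α + (k.γ - 1) * (k.centerConst * rate k.lam c n) := by
  have hγ := k.one_lt_γ
  have hlam := k.lam_mem.1
  have hC := k.centerConst_pos
  have hlen : segLen f (past c (n + 2)) ≤ k.L * k.lam ^ n :=
    hf.segLen_le (by rw [length_past]; omega)
  have hcenter : ∀ y ∈ seg f (past c (n + 2)),
      segLen f (past c (n + 2)) ≤ k.centerConst * rate k.lam c n * |y| := by
    intro y hy
    rw [past, past] at hy ⊢
    cases hc : c n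
    · rw [hc] at hy
      have := hf.segLen_cons_false_le (c (n + 1)) (past c n) y hy
      rw [length_past] at this
      simpa [rate, hc] using this
    · rw [hc] at hy
      obtain ⟨j, m, h1, h2⟩ := exists_past_eq k.lam c n (h hc)
      rw [h1] at hy ⊢
      have := hf.segLen_cons_true_le (c (n + 1)) (past c m) j y hy
      rw [length_past] at this
      refine this.trans ?_
      rw [rate, hc, cond_true, h2]
      gcongr
      exact le_add_of_nonneg_left (by positivity)
  refine (hf.abs_segRatio_sub_le (c (n + 1)) b hcenter).trans ?_
  refine add_le_add_left (mul_le_mul_of_nonneg_left ?_ k.K_pos.le) _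
  exact Real.rpow_le_rpow (hf.segLen_pos _).le hlen k.α_pos.le

/-- The ratios along a dual point form a Cauchy sequence, at a rate depending only on the
constants. -/
lemma exists_summable_dist_ratio (k : Bounds) (a : ℕ → Bool) :
    ∃ (d : ℕ → ℝ) (N : ℕ), Summable d ∧ ∀ f f' : ℝ → ℝ, Controlled k f f' →
      ∀ n, dist (ratio f a (n + N)) (ratio f a (n.succ + N)) ≤ d n := by
  set c : ℕ → Bool := fun i => a (i + 1) with hc
  obtain ⟨N, hN⟩ : ∃ N, ∀ n ≥ N, c n = true → ∃ i < n, c i = true := by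
    by_cases h : ∃ i, c i = true
    · obtain ⟨i, hi⟩ := h
      exact ⟨i + 1, fun n hn _ => ⟨i, hn, hi⟩⟩
    · exact ⟨0, fun n _ hn => absurd ⟨n, hn⟩ h⟩
  have hsum : Summable fun n : ℕ => k.K * (k.L * k.lam ^ n) ^ k.α +
      (k.γ - 1) * (k.centerConst * rate k.lam c n) :=
    (k.summable_rpow.mul_left _).add
      (((summable_rate k.lam_mem.1.le k.lam_mem.2 c).mul_left _).mul_left _)
  refine ⟨_, N + 1, (summable_nat_add_iff N).2 hsum, fun f f' hf n => ?_⟩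
  rw [hf.ratio_eq, hf.ratio_eq, Real.dist_eq, show n.succ + (N + 1) = n + N + 2 by omega]
  exact hf.abs_segRatio_past_sub_le c (a 0) (hN (n + N) (Nat.le_add_left N n))

lemma IsCompact.exists_abs_bounds {s : Set (ℝ × ℝ)} (hs : IsCompact s) {g : ℝ × ℝ → ℝ}
    (hg : ContinuousOn g s) (h0 : ∀ p ∈ s, g p ≠ 0) :
    ∃ c > 0, ∃ C > 0, ∀ p ∈ s, c ≤ |g p| ∧ |g p| ≤ C := by
  obtain ⟨C, hC⟩ := hs.exists_bound_of_continuousOn hg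
  rcases s.eq_empty_or_nonempty with rfl | hne
  · exact ⟨1, one_pos, 1, one_pos, by simp⟩
  · obtain ⟨p, hp, hmin⟩ := hs.exists_isMinOn hne hg.abs
    have hpos : 0 < |g p| := abs_pos.2 (h0 p hp)
    exact ⟨|g p|, hpos, C, hpos.trans_le (hC p hp), fun q hq => ⟨hmin hq, hC q hq⟩⟩

namespace GoodFamily

/-- The continuous extension of `f_ε'(x) / |x|^(γ - 1)` to `side b`. -/
def R (F : GoodFamily) : Bool → ℝ → ℝ → ℝ
  | false => F.Rneg
  | true => F.Rpos

lemma R_eq (F : GoodFamily) {b : Bool} {ε x : ℝ} (hε : ε ∈ Icc 0 F.eps0) (hx : x ∈ openSide b) :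
    F.R b ε x = F.f' ε x / |x| ^ (F.gamma - 1) := by
  cases b
  · exact F.Rneg_eq ε hε x ⟨hx.1.le, hx.2⟩
  · exact F.Rpos_eq ε hε x ⟨hx.1, hx.2.le⟩

lemma f'_eq (F : GoodFamily) {b : Bool} {ε x : ℝ} (hε : ε ∈ Icc 0 F.eps0) (hx : x ∈ openSide b) :
    F.f' ε x = F.R b ε x * |x| ^ (F.gamma - 1) := by
  have := abs_pos.2 (ne_zero_of_mem_openSide hx)
  rw [F.R_eq hε hx, div_mul_cancel₀ _ (by positivity)]

lemma holder_R (F : GoodFamily) {b : Bool} {ε x y : ℝ} (hε : ε ∈ Icc 0 F.eps0)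
    (hx : x ∈ openSide b) (hy : y ∈ openSide b) :
    |F.R b ε x - F.R b ε y| ≤ F.K'' * |x - y| ^ F.alpha'' := by
  rw [F.R_eq hε hx, F.R_eq hε hy]
  cases b
  · exact F.holder''_neg ε hε x ⟨hx.1.le, hx.2⟩ y ⟨hy.1.le, hy.2⟩
  · exact F.holder''_pos ε hε x ⟨hx.1, hx.2.le⟩ y ⟨hy.1, hy.2.le⟩

lemma exists_R_bounds (F : GoodFamily) :
    ∃ c > 0, ∃ C > 0, ∀ b, ∀ ε ∈ Icc 0 F.eps0, ∀ x ∈ openSide b,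
      c ≤ |F.R b ε x| ∧ |F.R b ε x| ≤ C := by
  obtain ⟨c, hc, C, hC, h⟩ := (isCompact_Icc.prod isCompact_Icc).exists_abs_bounds F.Rneg_cont
    fun p hp => F.Rneg_ne p.1 hp.1 p.2 hp.2
  obtain ⟨d, hd, D, hD, h'⟩ := (isCompact_Icc.prod isCompact_Icc).exists_abs_bounds F.Rpos_cont
    fun p hp => F.Rpos_ne p.1 hp.1 p.2 hp.2
  refine ⟨min c d, lt_min hc hd, max C D, lt_max_of_lt_left hC, fun b ε hε x hx => ?_⟩
  cases b
  · have := h (ε, x) ⟨hε, Ioo_subset_Icc_self hx⟩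
    exact ⟨(min_le_left _ _).trans this.1, this.2.trans (le_max_left _ _)⟩
  · have := h' (ε, x) ⟨hε, Ioo_subset_Icc_self hx⟩
    exact ⟨(min_le_right _ _).trans this.1, this.2.trans (le_max_right _ _)⟩

lemma fullUnimodal (F : GoodFamily) {ε : ℝ} (hε : ε ∈ Icc 0 F.eps0) : FullUnimodal (F.f ε) where
  cont x hx := (F.deriv_f ε hε x hx).continuousWithinAt
  mono := F.mono ε hε
  anti := F.anti ε hε
  map_neg_one := F.map_neg_one ε hε
  map_one := F.map_one ε hε
  one_le_map_zero := by rw [F.map_zero ε hε]; linarith [hε.1]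

lemma segLen_le (F : GoodFamily) {ε : ℝ} (hε : ε ∈ Icc 0 F.eps0) (w : List Bool) :
    segLen (F.f ε) w ≤ max 2 F.C0 / F.lam * F.lam ^ w.length := by
  have hf := F.fullUnimodal hε
  have hlam := F.lam_mem.1
  have htwo : segLen (F.f ε) w ≤ 2 := by
    have h1 := hf.gw_neg_one_mem w
    have h2 := hf.gw_one_mem w
    rw [segLen, abs_le]
    constructor <;> linarith [h1.1, h1.2, h2.1, h2.2]
  have hmax : 0 < max 2 F.C0 := by positivity
  have hshort : segLen (F.f ε) w ≤ max 2 F.C0 := htwo.trans (le_max_left _ _)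
  rcases hw : w.length with _ | _ | n
  · rw [pow_zero, mul_one]
    exact hshort.trans (le_div_self hmax.le hlam F.lam_mem.2.le)
  · rw [zero_add, pow_one, div_mul_cancel₀ _ hlam.ne']
    exact hshort
  · have h := F.decay ε hε (n + 1) (by omega) w hw
    rw [hf.len_Iw] at h
    rw [pow_succ' F.lam (n + 1), ← mul_assoc, div_mul_cancel₀ _ hlam.ne']
    exact h.trans (mul_le_mul_of_nonneg_right (le_max_right _ _) (by positivity))

/-- The members of a good family are controlled by common constants. -/
lemma exists_controlled (F : GoodFamily) :
    ∃ k : Bounds, ∀ ε ∈ Icc 0 F.eps0, Controlled k (F.f ε) (F.f' ε) := by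
  obtain ⟨c, hc, C, hC, hR⟩ := F.exists_R_bounds
  have hlam := F.lam_mem.1
  have hmem : ∀ x ∈ Ioo (-1 : ℝ) 1, x ≠ 0 → ∃ b, x ∈ openSide b := by
    intro x hx hx0
    rcases lt_or_gt_of_ne hx0 with h | h
    · exact ⟨false, hx.1, h⟩
    · exact ⟨true, h, hx.2⟩
  have habs : ∀ {b : Bool} {ε x : ℝ}, ε ∈ Icc 0 F.eps0 → x ∈ openSide b →
      |F.f' ε x| = |F.R b ε x| * |x| ^ (F.gamma - 1) := by
    intro b ε x hε hx
    rw [F.f'_eq hε hx, abs_mul, abs_of_nonneg (Real.rpow_nonneg (abs_nonneg x) _)]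
  refine ⟨⟨F.gamma, c, C, F.K'' / c, F.alpha'', max 2 F.C0 / F.lam, F.lam, F.one_lt_gamma, hc, hC,
    div_pos F.K''_pos hc, F.alpha''_mem.1, by positivity, F.lam_mem⟩, fun ε hε => ?_⟩
  refine { F.fullUnimodal hε with
    hasDerivAt := fun x hx => (F.deriv_f ε hε x (Ioo_subset_Icc_self hx)).hasDerivAt
      (Icc_mem_nhds hx.1 hx.2)
    lower := fun x hx hx0 => ?_
    upper := fun x hx hx0 => ?_
    distortion := fun b x hx y hy => ?_
    decay := F.segLen_le hε }
  · obtain ⟨b, hb⟩ := hmem x hx hx0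
    rw [habs hε hb]
    exact mul_le_mul_of_nonneg_right (hR b ε hε x hb).1 (Real.rpow_nonneg (abs_nonneg x) _)
  · obtain ⟨b, hb⟩ := hmem x hx hx0
    rw [habs hε hb]
    exact mul_le_mul_of_nonneg_right (hR b ε hε x hb).2 (Real.rpow_nonneg (abs_nonneg x) _)
  · have hRx := (hR b ε hε x hx).1
    have hRy := (hR b ε hε y hy).1
    have hlogf : ∀ z ∈ openSide b,
        Real.log (F.f' ε z) = Real.log (F.R b ε z) + (F.gamma - 1) * Real.log z := by
      intro z hz
      have hz0 := abs_pos.2 (ne_zero_of_mem_openSide hz)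
      have hRz := abs_pos.1 (hc.trans_le (hR b ε hε z hz).1)
      rw [F.f'_eq hε hz, Real.log_mul hRz (by positivity), Real.log_rpow hz0, Real.log_abs]
    have hquot : ∀ r : ℝ, c ≤ |r| → |F.R b ε x - F.R b ε y| ≤
        |F.R b ε x - F.R b ε y| / c * |r| := by
      intro r hr
      rw [div_mul_eq_mul_div, le_div_iff₀ hc]
      exact mul_le_mul_of_nonneg_left hr (abs_nonneg _)
    have hlogR : |Real.log (F.R b ε x) - Real.log (F.R b ε y)| ≤
        F.K'' / c * |x - y| ^ F.alpha'' := by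
      refine (abs_log_sub_le (abs_pos.1 (hc.trans_le hRx)) (abs_pos.1 (hc.trans_le hRy))
        (hquot _ hRx) (hquot _ hRy)).trans ?_
      rw [div_mul_eq_mul_div]
      exact div_le_div_of_nonneg_right (F.holder_R hε hx hy) hc.le
    have hγ : 0 ≤ F.gamma - 1 := by linarith [F.one_lt_gamma]
    rw [hlogf x hx, hlogf y hy, add_sub_add_comm, ← mul_sub]
    refine (abs_add_le _ _).trans (add_le_add hlogR ?_)
    rw [abs_mul, abs_of_nonneg hγ]

lemma zero_mem (F : GoodFamily) : (0 : ℝ) ∈ Icc 0 F.eps0 := ⟨le_rfl, F.eps0_pos.le⟩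

lemma tendsto_f (F : GoodFamily) {x : ℝ} (hx : x ∈ Icc (-1) 1) :
    Tendsto (fun ε => F.f ε x) (𝓝[Icc 0 F.eps0] 0) (𝓝 (F.f 0 x)) := by
  have h := F.smooth.continuousOn (0, x) ⟨F.zero_mem, hx⟩
  refine Tendsto.comp (f := fun ε : ℝ => (ε, x)) (g := fun p : ℝ × ℝ => F.f p.1 p.2) h
    (tendsto_nhdsWithin_iff.2 ⟨?_, ?_⟩)
  · exact (Continuous.prodMk_left x).continuousAt.tendsto.mono_left nhdsWithin_le_nhds
  · filter_upwards [self_mem_nhdsWithin] with ε hε using ⟨hε, hx⟩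

lemma tendsto_branch (F : GoodFamily) (b : Bool) {u : ℝ → ℝ}
    (hu : ∀ ε ∈ Icc 0 F.eps0, u ε ∈ Icc (-1) 1)
    (h : Tendsto u (𝓝[Icc 0 F.eps0] 0) (𝓝 (u 0))) :
    Tendsto (fun ε => branch (F.f ε) b (u ε)) (𝓝[Icc 0 F.eps0] 0)
      (𝓝 (branch (F.f 0) b (u 0))) := by
  have h0 := F.fullUnimodal F.zero_mem
  have hm0 := h0.branch_mem b (hu 0 F.zero_mem)
  have he0 := h0.map_branch b (hu 0 F.zero_mem)
  have hmem : ∀ᶠ ε in 𝓝[Icc 0 F.eps0] 0, ε ∈ Icc 0 F.eps0 := self_mem_nhdsWithin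
  have hm : ∀ ε ∈ Icc 0 F.eps0, branch (F.f ε) b (u ε) ∈ side b ∧
      F.f ε (branch (F.f ε) b (u ε)) = u ε := fun ε hε =>
    ⟨(F.fullUnimodal hε).branch_mem b (hu ε hε), (F.fullUnimodal hε).map_branch b (hu ε hε)⟩
  have hside : ∀ {y p q : ℝ}, p ∈ side b → q ∈ side b → p ≤ y → y ≤ q → y ∈ side b := by
    intro y p q hp hq hpy hyq
    cases b <;> exact ⟨hp.1.trans hpy, hyq.trans hq.2⟩
  -- comparison of `branch (F.f ε) b (u ε)` with a fixed point `y` of the side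
  have hcmp : ∀ y ∈ side b, ∀ᶠ ε in 𝓝[Icc 0 F.eps0] 0,
      (y < branch (F.f 0) b (u 0) → y < branch (F.f ε) b (u ε)) ∧
      (branch (F.f 0) b (u 0) < y → branch (F.f ε) b (u ε) < y) := by
    intro y hy
    have hty := F.tendsto_f (side_subset b hy)
    cases b
    · rw [← h0.mono.lt_iff_lt hy hm0, ← h0.mono.lt_iff_lt hm0 hy, he0]
      refine Filter.Eventually.and ?_ ?_
      · by_cases hlt : F.f 0 y < u 0
        · filter_upwards [hty.eventually_lt h hlt, hmem] with ε hlt' hε _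
          rwa [← (F.mono ε hε).lt_iff_lt hy (hm ε hε).1, (hm ε hε).2]
        · exact Eventually.of_forall fun ε h' => absurd h' hlt
      · by_cases hlt : u 0 < F.f 0 y
        · filter_upwards [h.eventually_lt hty hlt, hmem] with ε hlt' hε _
          rwa [← (F.mono ε hε).lt_iff_lt (hm ε hε).1 hy, (hm ε hε).2]
        · exact Eventually.of_forall fun ε h' => absurd h' hlt
    · rw [← h0.anti.lt_iff_gt hm0 hy, ← h0.anti.lt_iff_gt hy hm0, he0]
      refine Filter.Eventually.and ?_ ?_
      · by_cases hlt : u 0 < F.f 0 y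
        · filter_upwards [h.eventually_lt hty hlt, hmem] with ε hlt' hε _
          rwa [← (F.anti ε hε).lt_iff_gt (hm ε hε).1 hy, (hm ε hε).2]
        · exact Eventually.of_forall fun ε h' => absurd h' hlt
      · by_cases hlt : F.f 0 y < u 0
        · filter_upwards [hty.eventually_lt h hlt, hmem] with ε hlt' hε _
          rwa [← (F.anti ε hε).lt_iff_gt hy (hm ε hε).1, (hm ε hε).2]
        · exact Eventually.of_forall fun ε h' => absurd h' hlt
  refine tendsto_order.2 ⟨fun y hy => ?_, fun y hy => ?_⟩
  · by_cases hys : y ∈ side b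
    · filter_upwards [hcmp y hys] with ε hε using hε.1 hy
    · filter_upwards [hmem] with ε hε
      by_contra hle
      exact hys (hside (hm ε hε).1 hm0 (not_lt.1 hle) hy.le)
  · by_cases hys : y ∈ side b
    · filter_upwards [hcmp y hys] with ε hε using hε.2 hy
    · filter_upwards [hmem] with ε hε
      by_contra hle
      exact hys (hside hm0 (hm ε hε).1 hy.le (not_lt.1 hle))

lemma tendsto_gw (F : GoodFamily) (w : List Bool) {x : ℝ} (hx : x ∈ Icc (-1) 1) :
    Tendsto (fun ε => gw (F.f ε) w x) (𝓝[Icc 0 F.eps0] 0) (𝓝 (gw (F.f 0) w x)) := by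
  induction w with
  | nil => exact tendsto_const_nhds
  | cons b w ih => exact F.tendsto_branch b (fun ε hε => (F.fullUnimodal hε).gw_mem w hx) ih

lemma tendsto_ratio (F : GoodFamily) (a : ℕ → Bool) (n : ℕ) :
    Tendsto (fun ε => ratio (F.f ε) a n) (𝓝[Icc 0 F.eps0] 0) (𝓝 (ratio (F.f 0) a n)) := by
  have hlen : ∀ w, Tendsto (fun ε => segLen (F.f ε) w) (𝓝[Icc 0 F.eps0] 0)
      (𝓝 (segLen (F.f 0) w)) := fun w =>
    ((F.tendsto_gw w (by norm_num)).sub (F.tendsto_gw w (by norm_num))).abs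
  have h0 := F.fullUnimodal F.zero_mem
  rw [h0.ratio_eq]
  refine ((hlen _).div (hlen _) (h0.segLen_pos _).ne').congr' ?_
  filter_upwards [self_mem_nhdsWithin] with ε hε
  exact ((F.fullUnimodal hε).ratio_eq a n).symm

end GoodFamily

/-- Theorem A, part 2, existence of the limit: for a good family with
scaling functions `s_ε` (`0 < ε ≤ ε₀`), for every dual point `a*` the limit `s₀(a*)` of
`s_ε(a*)` as `ε ↓ 0` exists, and the limiting function `s₀` is the scaling function of
`f₀`. -/
theorem limit_scaling_function_exists (F : GoodFamily) (s : ℝ → (ℕ → Bool) → ℝ)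
    (hs : ∀ ε ∈ Ioc 0 F.eps0, IsScalingFun (F.f ε) (s ε)) :
    ∃ s0 : (ℕ → Bool) → ℝ,
      (∀ a : ℕ → Bool,
        Tendsto (fun ε => s ε a) (nhdsWithin 0 (Ioc 0 F.eps0)) (nhds (s0 a))) ∧
      IsScalingFun (F.f 0) s0 := by
  obtain ⟨k, hk⟩ := F.exists_controlled
  suffices h : ∀ a, ∃ l, Tendsto (fun ε => s ε a) (nhdsWithin 0 (Ioc 0 F.eps0)) (nhds l) ∧
      Tendsto (ratio (F.f 0) a) atTop (nhds l) by
    choose s0 h1 h2 using h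
    exact ⟨s0, h1, h2⟩
  intro a
  obtain ⟨d, N, hd, hdist⟩ := exists_summable_dist_ratio k a
  have h0 := hdist _ _ (hk 0 F.zero_mem)
  obtain ⟨l, hl⟩ := cauchySeq_tendsto_of_complete (cauchySeq_of_dist_le_of_summable d h0 hd)
  refine ⟨l, ?_, (tendsto_add_atTop_iff_nat N).1 hl⟩
  have htail : Tendsto (fun n => ∑' m, d (n + m)) atTop (𝓝 0) := by
    simpa only [add_comm] using tendsto_sum_nat_add d
  have hunif : TendstoUniformlyOn (fun n ε => ratio (F.f ε) a (n + N)) (fun ε => s ε a) atTop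
      (Ioc 0 F.eps0) := by
    rw [Metric.tendstoUniformlyOn_iff]
    intro r hr
    filter_upwards [htail.eventually_lt_const hr] with n hn ε hε
    rw [dist_comm]
    exact (dist_le_tsum_of_dist_le_of_tendsto d (hdist _ _ (hk ε (Ioc_subset_Icc_self hε))) hd
      ((tendsto_add_atTop_iff_nat N).2 (hs ε hε a)) n).trans_lt hn
  exact (hunif.tendstoUniformlyOnFilter.mono_right inf_le_right).tendsto_of_eventually_tendsto
    (Eventually.of_forall fun n =>
    (F.tendsto_ratio a (n + N)).mono_left (nhdsWithin_mono 0 Ioc_subset_Icc_self)) hl
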